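/- Let L be a ℤ-module and A : L → L an endomorphism satisfying A ∘ (id − A) = 2·id (equivalently A² − A + 2·id = 0). Then A(L) + (id − A)(L) = L and A(L) ∩ (id − A)(L) = 2L. If moreover B : L × L → ℤ is a symmetric bilinear form such that B(Ax, y) = B(x, y − Ay) for all x, y ∈ L (i.e. the B-adjoint of A is id − A), then B(Ax, Ay) = 2·B(x,y) and B(x − Ax, y − Ay) = 2·B(x,y) for all x, y ∈ L. -/

import Mathlib

/-- For an endomorphism `A` of a `ℤ`-module `L` with `A(id - A) = 2·id`,
the images `M = A(L)` and `N = (id - A)(L)` satisfy `M + N = L` and `M ∩ N = 2L`;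
moreover if a symmetric bilinear form `B` has `B`-adjoint of `A` equal to `id - A`
then `A` and `id - A` scale `B` by 2. -/
theorem stmt4 {L : Type*} [AddCommGroup L] [Module ℤ L]
    (A : L →ₗ[ℤ] L) (hA : ∀ x, A (x - A x) = (2 : ℤ) • x) :
    (LinearMap.range A ⊔ LinearMap.range (LinearMap.id - A) = ⊤) ∧
    (LinearMap.range A ⊓ LinearMap.range (LinearMap.id - A)
        = LinearMap.range ((2 : ℤ) • (LinearMap.id : L →ₗ[ℤ] L))) ∧
    ∀ B : L →ₗ[ℤ] L →ₗ[ℤ] ℤ,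
      (∀ x y, B x y = B y x) →
      (∀ x y, B (A x) y = B x (y - A y)) →
      ∀ x y, B (A x) (A y) = 2 * B x y ∧ B (x - A x) (y - A y) = 2 * B x y := by
  simp only [two_zsmul] at hA ⊢
  have hA' (x : L) : A x - A (A x) = x + x := by rw [← map_sub, hA]
  refine ⟨?_, ?_, fun B _ hB x y => ⟨?_, ?_⟩⟩
  · refine eq_top_iff.mpr fun x _ => Submodule.mem_sup.mpr
      ⟨A x, ⟨x, rfl⟩, x - A x, ⟨x, rfl⟩, add_sub_cancel _ _⟩
  · refine le_antisymm ?_ ?_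
    · rintro z ⟨⟨a, ha⟩, ⟨b, hb⟩⟩
      replace hb : b - A b = z := hb
      have hz : z - A z = a + a := by rw [← ha, hA']
      have hAz : A z = b + b := by rw [← hb, hA]
      refine ⟨a + b, ?_⟩
      change (a + b) + (a + b) = z
      rw [add_add_add_comm, ← hz, ← hAz, sub_add_cancel]
    · rintro _ ⟨x, rfl⟩
      exact ⟨⟨x - A x, hA x⟩, ⟨A x, hA' x⟩⟩
  · rw [hB, hA', map_add, two_mul]
  · rw [← hB, hA, map_add, LinearMap.add_apply, two_mul]
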